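/- For each d in the set {−1103784, −1356215, −518835, −761855, −553807, −763972, −876948, −1100315, −1407379, −1677327, −1727187, −194703, −494771, −150319, −294983, −389435}, the 3-primary part (the Sylow 3-subgroup) of the ideal class group of the ring of integers of the imaginary quadratic field ℚ(√d) is isomorphic to C9 × C3; equivalently, the 3-class group Cl₃(ℚ(√d)) is a non-elementary bicyclic group of rank two and order 27. -/

import Mathlib

/-- The norm of `b + ω`, where `ω` is a root of `X ^ 2 - t X + n`. -/
def quadNorm (t n b : ℤ) : ℤ := b * b + t * b + n

/-- `O` has `ℤ`-basis `1, ω`, where `ω ^ 2 = t ω - n`, the discriminant `t ^ 2 - 4 n` is negative,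
and every form `(a, 2 b + t, c)` of that discriminant is primitive. -/
structure IsImagQuadOrder {O : Type*} [CommRing O] (t n : ℤ) (ω : O) : Prop where
  mul_self : ω * ω = t * ω - n
  exists_coord : ∀ x : O, ∃ u v : ℤ, x = u + v * ω
  coord_eq_zero : ∀ u v : ℤ, (u : O) + v * ω = 0 → u = 0 ∧ v = 0
  disc_neg : t * t < 4 * n
  primitive : ∀ a b c g : ℤ, a * c = quadNorm t n b → g ∣ a → g ∣ c → g ∣ 2 * b + t → IsUnit g

/-- The ideal attached to the form `(a, 2 b + t, c)`. -/
def formIdeal {O : Type*} [CommRing O] (ω : O) (a b : ℤ) : Ideal O :=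
  Ideal.span {(a : O), (b : O) + ω}

theorem quadNorm_conj (t n b : ℤ) : quadNorm t n (-b - t) = quadNorm t n b := by
  simp only [quadNorm]; ring

theorem exists_bezout_of_isUnit {x y z : ℤ} (h : ∀ g : ℤ, g ∣ x → g ∣ y → g ∣ z → IsUnit g) :
    ∃ p q r : ℤ, p * x + q * y + r * z = 1 := by
  have hu : IsUnit ((Int.gcd (Int.gcd x y) z : ℕ) : ℤ) := by
    apply h
    · exact (Int.gcd_dvd_left _ _).trans (Int.gcd_dvd_left _ _)
    · exact (Int.gcd_dvd_left _ _).trans (Int.gcd_dvd_right _ _)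
    · exact Int.gcd_dvd_right _ _
  have h1 : Int.gcd (Int.gcd x y) z = 1 := by simpa using Int.isUnit_iff_natAbs_eq.1 hu
  have e1 := Int.gcd_eq_gcd_ab (Int.gcd x y) z
  have e2 := Int.gcd_eq_gcd_ab x y
  rw [h1] at e1
  rw [e2] at e1
  refine ⟨x.gcdA y * Int.gcdA (x.gcd y) z, x.gcdB y * Int.gcdA (x.gcd y) z,
    Int.gcdB (x.gcd y) z, ?_⟩
  rw [← e2] at e1
  push_cast at e1
  rw [e1, e2]
  ring

namespace IsImagQuadOrder

variable {O : Type*} [CommRing O] {t n : ℤ} {ω : O}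

theorem quadNorm_pos (h : IsImagQuadOrder t n ω) (b : ℤ) : 0 < quadNorm t n b := by
  have := h.disc_neg
  unfold quadNorm
  nlinarith [sq_nonneg (2 * b + t)]

theorem add_ne_zero (h : IsImagQuadOrder t n ω) (b : ℤ) : (b : O) + ω ≠ 0 := fun h0 => by
  have := h.coord_eq_zero b 1 (by simpa using h0)
  simp at this

theorem intCast_ne_zero (h : IsImagQuadOrder t n ω) {a : ℤ} (ha : a ≠ 0) : (a : O) ≠ 0 :=
  fun h0 => ha (h.coord_eq_zero a 0 (by simpa using h0)).1

theorem add_mul_conj (h : IsImagQuadOrder t n ω) (b : ℤ) :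
    ((b : O) + ω) * (b + t - ω) = (quadNorm t n b : ℤ) := by
  simp only [quadNorm]; push_cast
  linear_combination -h.mul_self

theorem coord_unique (h : IsImagQuadOrder t n ω) {u v u' v' : ℤ}
    (e : (u : O) + v * ω = u' + v' * ω) : u = u' ∧ v = v' := by
  have := h.coord_eq_zero (u - u') (v - v') (by push_cast; linear_combination e)
  omega

theorem coord_mul (h : IsImagQuadOrder t n ω) (u v x y : ℤ) :
    ((u : O) + v * ω) * (x + y * ω) =
      ((u * x - n * v * y : ℤ) : O) + ((u * y + v * x + t * v * y : ℤ) : O) * ω := by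
  push_cast
  linear_combination (v * y : O) * h.mul_self

theorem formIdeal_ne_bot (h : IsImagQuadOrder t n ω) (a b : ℤ) : formIdeal ω a b ≠ ⊥ := by
  intro h0
  have : (b : O) + ω ∈ formIdeal ω a b := Ideal.subset_span (by simp)
  rw [h0] at this
  exact h.add_ne_zero b (by simpa using this)

theorem formIdeal_congr {a b b' : ℤ} (hab : a ∣ b - b') : formIdeal ω a b = formIdeal ω a b' := by
  obtain ⟨k, hk⟩ := hab
  have e : (b : O) - b' = a * k := by exact_mod_cast congrArg (Int.cast : ℤ → O) hk
  apply le_antisymm <;> rw [formIdeal, Ideal.span_le, Set.insert_subset_iff,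
    Set.singleton_subset_iff] <;> simp only [SetLike.mem_coe, formIdeal, Ideal.mem_span_pair]
  · exact ⟨⟨1, 0, by ring⟩, ⟨k, 1, by linear_combination -e⟩⟩
  · exact ⟨⟨1, 0, by ring⟩, ⟨-k, 1, by linear_combination e⟩⟩

theorem formIdeal_mul (h : IsImagQuadOrder t n ω) {a a' b : ℤ} (hd : a * a' ∣ quadNorm t n b)
    (hg : ∀ g : ℤ, g ∣ a → g ∣ a' → g ∣ 2 * b + t → IsUnit g) :
    formIdeal ω a b * formIdeal ω a' b = formIdeal ω (a * a') b := by
  obtain ⟨p, q, r, e⟩ := exists_bezout_of_isUnit hg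
  obtain ⟨k, hk⟩ := hd
  have e' : (p : O) * a + q * a' + r * (2 * b + t) = 1 := by
    exact_mod_cast congrArg (Int.cast : ℤ → O) e
  have hk' : (b : O) * b + t * b + n = a * a' * k := by
    exact_mod_cast congrArg (Int.cast : ℤ → O) hk
  have hm := h.mul_self
  rw [formIdeal, formIdeal, Ideal.span_pair_mul_span_pair]
  apply le_antisymm
  · rw [Ideal.span_le]
    simp only [Set.insert_subset_iff, Set.singleton_subset_iff, SetLike.mem_coe, formIdeal,
      Ideal.mem_span_pair, Int.cast_mul]
    refine ⟨⟨1, 0, by ring⟩, ⟨0, a, by ring⟩, ⟨0, a', by ring⟩, ⟨-k, 2 * b + t, ?_⟩⟩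
    linear_combination hk' - hm
  · rw [formIdeal, Ideal.span_le]
    have m1 : (a : O) * a' ∈ Ideal.span
        {(a : O) * a', (a : O) * (b + ω), (b + ω) * (a' : O), (b + ω) * (b + ω)} :=
      Ideal.subset_span (by simp)
    have m2 : (a : O) * (b + ω) ∈ Ideal.span
        {(a : O) * a', (a : O) * (b + ω), (b + ω) * (a' : O), (b + ω) * (b + ω)} :=
      Ideal.subset_span (by simp)
    have m3 : (b + ω) * (a' : O) ∈ Ideal.span
        {(a : O) * a', (a : O) * (b + ω), (b + ω) * (a' : O), (b + ω) * (b + ω)} :=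
      Ideal.subset_span (by simp)
    have m4 : (b + ω) * ((b : O) + ω) ∈ Ideal.span
        {(a : O) * a', (a : O) * (b + ω), (b + ω) * (a' : O), (b + ω) * (b + ω)} :=
      Ideal.subset_span (by simp)
    simp only [Set.insert_subset_iff, Set.singleton_subset_iff, SetLike.mem_coe, Int.cast_mul]
    refine ⟨m1, ?_⟩
    have := add_mem (add_mem (Ideal.mul_mem_left _ (p : O) m2) (Ideal.mul_mem_left _ (q : O) m3))
      (add_mem (Ideal.mul_mem_left _ (r : O) m4) (Ideal.mul_mem_left _ ((r : O) * k) m1))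
    convert this using 1
    linear_combination (-(b + ω)) * e' + r * hk' - r * hm

theorem span_mul_formIdeal (h : IsImagQuadOrder t n ω) {a b c : ℤ} (hc : a * c = quadNorm t n b) :
    Ideal.span {(b + t - ω : O)} * formIdeal ω a b =
      Ideal.span {(a : O)} * formIdeal ω c (-b - t) := by
  have hc' : (b : O) * b + t * b + n = a * c := by
    exact_mod_cast congrArg (Int.cast : ℤ → O) hc.symm
  have hm := h.mul_self
  have key := h.add_mul_conj b
  rw [← hc] at key
  push_cast at key
  simp only [formIdeal, Ideal.span_mul_span', Set.singleton_mul, Set.image_pair]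
  apply le_antisymm <;> rw [Ideal.span_le] <;>
    simp only [Set.insert_subset_iff, Set.singleton_subset_iff, SetLike.mem_coe,
      Ideal.mem_span_pair] <;> push_cast
  · exact ⟨⟨0, -1, by ring⟩, ⟨1, 0, by linear_combination -key⟩⟩
  · exact ⟨⟨0, 1, by linear_combination key⟩, ⟨-1, 0, by ring⟩⟩

theorem formIdeal_mul_conj (h : IsImagQuadOrder t n ω) {a b : ℤ} (hd : a ∣ quadNorm t n b) :
    formIdeal ω a b * formIdeal ω a (-b - t) = Ideal.span {(a : O)} := by
  obtain ⟨c, hc⟩ := hd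
  obtain ⟨p, q, r, e⟩ := exists_bezout_of_isUnit (fun g => h.primitive a b c g hc.symm)
  have e' : (p : O) * a + q * c + r * (2 * b + t) = 1 := by
    exact_mod_cast congrArg (Int.cast : ℤ → O) e
  have key := h.add_mul_conj b
  rw [hc] at key
  push_cast at key
  rw [formIdeal, formIdeal, Ideal.span_pair_mul_span_pair]
  apply le_antisymm
  · rw [Ideal.span_le]
    simp only [Set.insert_subset_iff, Set.singleton_subset_iff, SetLike.mem_coe,
      Ideal.mem_span_singleton]
    refine ⟨⟨a, rfl⟩, ⟨_, rfl⟩, ⟨_, mul_comm _ _⟩, ⟨-c, ?_⟩⟩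
    push_cast
    linear_combination -key
  · rw [Ideal.span_singleton_le_iff_mem]
    set J := Ideal.span {(a : O) * a, a * (((-b - t : ℤ) : O) + ω), (b + ω) * (a : O),
      (b + ω) * (((-b - t : ℤ) : O) + ω)} with hJ
    have m1 : (a : O) * a ∈ J := Ideal.subset_span (by simp)
    have m2 : (a : O) * (((-b - t : ℤ) : O) + ω) ∈ J := Ideal.subset_span (by simp)
    have m3 : (b + ω) * (a : O) ∈ J := Ideal.subset_span (by simp)
    have m4 : (b + ω) * (((-b - t : ℤ) : O) + ω) ∈ J := Ideal.subset_span (by simp)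
    have := add_mem (add_mem (Ideal.mul_mem_left _ (p : O) m1) (Ideal.mul_mem_left _ (-q : O) m4))
      (sub_mem (Ideal.mul_mem_left _ (r : O) m3) (Ideal.mul_mem_left _ (r : O) m2))
    convert this using 1
    push_cast
    linear_combination (-(a : O)) * e' - q * key

theorem dvd_of_mem_formIdeal (h : IsImagQuadOrder t n ω) {a b u v : ℤ} (hd : a ∣ quadNorm t n b)
    (hm : (u : O) + v * ω ∈ formIdeal ω a b) : a ∣ u - b * v := by
  obtain ⟨x, y, e⟩ := Ideal.mem_span_pair.1 hm
  obtain ⟨x1, x2, rfl⟩ := h.exists_coord x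
  obtain ⟨y1, y2, rfl⟩ := h.exists_coord y
  obtain ⟨c, hc⟩ := hd
  have := h.coord_unique (u := a * x1 + y1 * b - n * y2) (v := a * x2 + y1 + y2 * b + t * y2)
    (u' := u) (v' := v) (by
      rw [← e]; push_cast; linear_combination -(y2 : O) * h.mul_self)
  refine ⟨x1 - b * x2 - c * y2, ?_⟩
  rw [← this.1, ← this.2]
  unfold quadNorm at hc
  linear_combination -y2 * hc

theorem not_isPrincipal_formIdeal (h : IsImagQuadOrder t n ω) {a b : ℤ} (h1 : 1 < a)
    (hlt : 4 * a < 4 * n - t * t) (hd : a ∣ quadNorm t n b) : ¬ (formIdeal ω a b).IsPrincipal := by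
  rintro ⟨α, hα⟩
  have hα' : formIdeal ω a b = Ideal.span {α} := hα
  obtain ⟨u, v, rfl⟩ := h.exists_coord α
  have ha : (a : O) ∈ Ideal.span {(u : O) + v * ω} := hα' ▸ Ideal.subset_span (by simp)
  have hb : (b : O) + ω ∈ Ideal.span {(u : O) + v * ω} := hα' ▸ Ideal.subset_span (by simp)
  obtain ⟨β, hβ⟩ := Ideal.mem_span_singleton.1 ha
  obtain ⟨γ, hγ⟩ := Ideal.mem_span_singleton.1 hb
  obtain ⟨x, y, rfl⟩ := h.exists_coord β
  obtain ⟨z, w, rfl⟩ := h.exists_coord γ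
  rw [h.coord_mul] at hβ hγ
  obtain ⟨e1, e2⟩ := h.coord_unique (u := a) (v := 0) (Eq.trans (by simp) hβ)
  obtain ⟨e3, e4⟩ := h.coord_unique (u := b) (v := 1) (Eq.trans (by simp) hγ)
  have hnorm : (u * u + t * u * v + n * v * v) * (x * x + t * x * y + n * y * y) = a * a := by
    have : (u * u + t * u * v + n * v * v) * (x * x + t * x * y + n * y * y) =
      (u * x - n * v * y) * (u * x - n * v * y) + t * (u * x - n * v * y) *
        (u * y + v * x + t * v * y) + n * (u * y + v * x + t * v * y) *
        (u * y + v * x + t * v * y) := by ring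
    rw [this, ← e1, ← e2]; ring
  have hv : v = 0 := by
    by_contra hv
    have big : ∀ p q : ℤ, q ≠ 0 → a < p * p + t * p * q + n * q * q := by
      intro p q hq
      have : 0 < q * q := mul_self_pos.2 hq
      nlinarith [sq_nonneg (2 * p + t * q)]
    have hu := big u v hv
    by_cases hy : y = 0
    · rw [hy] at e2
      have : v * x = 0 := by linarith
      rcases mul_eq_zero.1 this with h0 | h0
      · exact hv h0
      · simp [h0, hy] at e1; omega
    · have := big x y hy
      nlinarith
  subst hv
  have huu : u ∣ 1 := ⟨w, by linarith⟩
  have hmem : ((1 : ℤ) : O) + (0 : ℤ) * ω ∈ formIdeal ω a b := by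
    rw [hα', Ideal.mem_span_singleton]
    obtain ⟨k, hk⟩ := huu
    refine ⟨k, ?_⟩
    have : (u : O) * k = 1 := by exact_mod_cast congrArg (Int.cast : ℤ → O) hk.symm
    simp [this]
  have := h.dvd_of_mem_formIdeal hd hmem
  have := Int.le_of_dvd (by simp) this
  simp at this
  omega

theorem exists_span_mul_formIdeal (h : IsImagQuadOrder t n ω) {J : Ideal O} (hJ : J ≠ ⊥) :
    ∃ g a b : ℤ, g ≠ 0 ∧ 0 < a ∧ a ∣ quadNorm t n b ∧
      J = Ideal.span {(g : O)} * formIdeal ω a b := by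
  let V : Ideal ℤ :=
    { carrier := {v | ∃ u : ℤ, (u : O) + v * ω ∈ J}
      add_mem' := by
        rintro v v' ⟨u, hu⟩ ⟨u', hu'⟩
        exact ⟨u + u', by convert add_mem hu hu' using 1; push_cast; ring⟩
      zero_mem' := ⟨0, by simp⟩
      smul_mem' := by
        rintro k v ⟨u, hu⟩
        exact ⟨k * u, by convert Ideal.mul_mem_left J (k : O) hu using 1; simp; ring⟩ }
  let U : Ideal ℤ := J.comap (Int.castRingHom O)
  have hU : ∀ u : ℤ, u ∈ U ↔ (u : O) ∈ J := fun u => Iff.rfl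
  obtain ⟨g, hg⟩ := (inferInstance : V.IsPrincipal).principal
  obtain ⟨a0, ha0⟩ := (inferInstance : U.IsPrincipal).principal
  have hV' : ∀ u v : ℤ, (u : O) + v * ω ∈ J → g ∣ v := fun u v huv => by
    have : v ∈ V := ⟨u, huv⟩
    rw [hg] at this
    exact Ideal.mem_span_singleton.1 this
  have hU' : ∀ u : ℤ, (u : O) ∈ J → a0 ∣ u := fun u hu => by
    have : u ∈ U := hu
    rw [ha0] at this
    exact Ideal.mem_span_singleton.1 this
  have hgV : g ∈ V := by rw [hg]; exact Ideal.mem_span_singleton_self g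
  have haU : (a0 : O) ∈ J := by
    have : a0 ∈ U := by rw [ha0]; exact Ideal.mem_span_singleton_self a0
    exact this
  obtain ⟨s, hs⟩ := hgV
  have hs2 : ((-(n * g) : ℤ) : O) + ((s + t * g : ℤ) : O) * ω ∈ J := by
    convert Ideal.mul_mem_left J ω hs using 1
    push_cast
    linear_combination -(g : O) * h.mul_self
  have hgs : g ∣ s := by
    have := hV' _ _ hs2
    rwa [dvd_add_left (Dvd.intro_left t rfl)] at this
  have hga : g ∣ a0 := hV' 0 a0 (by simpa [mul_comm] using Ideal.mul_mem_left J ω haU)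
  obtain ⟨b, rfl⟩ := hgs
  obtain ⟨a, rfl⟩ := hga
  have hgJ : (g : O) * (b + ω) ∈ J := by convert hs using 1; push_cast; ring
  have hmain : J = Ideal.span {(g : O)} * formIdeal ω a b := by
    simp only [formIdeal, Ideal.span_mul_span', Set.singleton_mul, Set.image_pair]
    apply le_antisymm
    · intro x hx
      obtain ⟨u, v, rfl⟩ := h.exists_coord x
      obtain ⟨k, rfl⟩ := hV' u v hx
      have : ((u - g * b * k : ℤ) : O) ∈ J := by
        convert sub_mem hx (Ideal.mul_mem_left J (k : O) hs) using 1
        push_cast; ring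
      obtain ⟨l, hl⟩ := hU' _ this
      have hl' : (u : O) - g * b * k = g * a * l := by
        exact_mod_cast congrArg (Int.cast : ℤ → O) hl
      rw [Ideal.mem_span_pair]
      refine ⟨l, k, ?_⟩
      push_cast
      linear_combination -hl'
    · rw [Ideal.span_le]
      simp only [Set.insert_subset_iff, Set.singleton_subset_iff, SetLike.mem_coe]
      exact ⟨by exact_mod_cast haU, hgJ⟩
  have hg0 : g ≠ 0 := by
    rintro rfl
    apply hJ
    rw [hmain]; simp
  have hdvd : a ∣ quadNorm t n b := by
    have : ((g * quadNorm t n b : ℤ) : O) ∈ J := by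
      convert Ideal.mul_mem_right ((b : O) + t - ω) J hgJ using 1
      push_cast
      rw [mul_assoc, h.add_mul_conj]
    exact Int.dvd_of_mul_dvd_mul_left hg0 (hU' _ this)
  have ha0 : a ≠ 0 := by
    rintro rfl
    have := h.quadNorm_pos b
    rw [zero_dvd_iff] at hdvd
    omega
  rcases lt_or_gt_of_ne ha0 with hlt | hgt
  · refine ⟨g, -a, b, hg0, by omega, by simpa using hdvd, ?_⟩
    rw [hmain]
    congr 1
    simp only [formIdeal, Ideal.span_insert, Int.cast_neg, Ideal.span_singleton_neg]
  · exact ⟨g, a, b, hg0, hgt, hdvd, hmain⟩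

end IsImagQuadOrder

/-- The class of the ideal attached to the form `(a, 2 b + t, c)`. -/
noncomputable def formClass {O : Type*} [CommRing O] [IsDedekindDomain O] (ω : O) (a b : ℤ) :
    ClassGroup O :=
  open Classical in
  if h : formIdeal ω a b ∈ nonZeroDivisors (Ideal O) then ClassGroup.mk0 ⟨formIdeal ω a b, h⟩ else 1

namespace IsImagQuadOrder

variable {O : Type*} [CommRing O] [IsDedekindDomain O] {t n : ℤ} {ω : O}

theorem formIdeal_mem (h : IsImagQuadOrder t n ω) (a b : ℤ) :
    formIdeal ω a b ∈ nonZeroDivisors (Ideal O) :=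
  mem_nonZeroDivisors_iff_ne_zero.2 (h.formIdeal_ne_bot a b)

theorem formClass_eq (h : IsImagQuadOrder t n ω) (a b : ℤ) :
    formClass ω a b = ClassGroup.mk0 ⟨formIdeal ω a b, h.formIdeal_mem a b⟩ := by
  rw [formClass, dif_pos]

theorem formClass_congr {a b b' : ℤ} (hab : a ∣ b - b') : formClass ω a b = formClass ω a b' := by
  rw [formClass, formClass, formIdeal_congr hab]

theorem formClass_mul (h : IsImagQuadOrder t n ω) {a a' b : ℤ} (hd : a * a' ∣ quadNorm t n b)
    (hg : ∀ g : ℤ, g ∣ a → g ∣ a' → g ∣ 2 * b + t → IsUnit g) :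
    formClass ω a b * formClass ω a' b = formClass ω (a * a') b := by
  rw [h.formClass_eq, h.formClass_eq, h.formClass_eq, ← map_mul]
  congr 1
  exact Subtype.ext (h.formIdeal_mul hd hg)

theorem formClass_swap (h : IsImagQuadOrder t n ω) {a b c : ℤ} (ha : a ≠ 0)
    (hc : a * c = quadNorm t n b) : formClass ω a b = formClass ω c (-b - t) := by
  rw [h.formClass_eq, h.formClass_eq, ClassGroup.mk0_eq_mk0_iff]
  refine ⟨b + t - ω, a, ?_, h.intCast_ne_zero ha, h.span_mul_formIdeal hc⟩
  intro h0
  apply h.add_ne_zero (-b - t)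
  push_cast
  linear_combination -h0

theorem formClass_conj (h : IsImagQuadOrder t n ω) {a b : ℤ} (hd : a ∣ quadNorm t n b) :
    formClass ω a (-b - t) = (formClass ω a b)⁻¹ := by
  rw [eq_inv_iff_mul_eq_one, mul_comm, h.formClass_eq, h.formClass_eq, ← map_mul,
    Submonoid.mk_mul_mk, ClassGroup.mk0_eq_one_iff, h.formIdeal_mul_conj hd]
  exact ⟨_, rfl⟩

theorem formClass_one (h : IsImagQuadOrder t n ω) (b : ℤ) : formClass ω 1 b = 1 := by
  rw [h.formClass_eq, ClassGroup.mk0_eq_one_iff]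
  refine ⟨1, ?_⟩
  have : (1 : O) ∈ formIdeal ω 1 b := Ideal.subset_span (by simp)
  rw [(Ideal.eq_top_iff_one _).2 this]
  simp

theorem formClass_ne_one (h : IsImagQuadOrder t n ω) {a b : ℤ} (h1 : 1 < a)
    (hlt : 4 * a < 4 * n - t * t) (hd : a ∣ quadNorm t n b) : formClass ω a b ≠ 1 := by
  rw [h.formClass_eq, Ne, ClassGroup.mk0_eq_one_iff]
  exact h.not_isPrincipal_formIdeal h1 hlt hd

theorem exists_formClass (h : IsImagQuadOrder t n ω) (x : ClassGroup O) :
    ∃ a b : ℤ, 0 < a ∧ a ∣ quadNorm t n b ∧ x = formClass ω a b := by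
  obtain ⟨⟨J, hJ⟩, rfl⟩ := ClassGroup.mk0_surjective x
  obtain ⟨g, a, b, hg, ha, hd, e⟩ :=
    h.exists_span_mul_formIdeal (mem_nonZeroDivisors_iff_ne_zero.1 hJ)
  refine ⟨a, b, ha, hd, ?_⟩
  rw [h.formClass_eq, ClassGroup.mk0_eq_mk0_iff]
  refine ⟨1, g, one_ne_zero, h.intCast_ne_zero hg, ?_⟩
  rw [← e]
  simp

end IsImagQuadOrder

/-- All classes of forms with leading coefficient `a` lie in `S`. -/
def ClassesIn {O : Type*} [CommRing O] [IsDedekindDomain O] (t n : ℤ) (ω : O)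
    (S : Subgroup (ClassGroup O)) (a : ℕ) : Prop :=
  ∀ b : ℤ, (a : ℤ) ∣ quadNorm t n b → formClass ω a b ∈ S

namespace IsImagQuadOrder

variable {O : Type*} [CommRing O] [IsDedekindDomain O] {t n : ℤ} {ω : O}
  {S : Subgroup (ClassGroup O)}

theorem classesIn_mul (h : IsImagQuadOrder t n ω) {x y : ℕ}
    (hx : ClassesIn t n ω S x) (hy : ClassesIn t n ω S y) : ClassesIn t n ω S (x * y) := by
  intro b hb
  obtain ⟨c, hc⟩ := hb
  push_cast at hc ⊢
  rw [← h.formClass_mul ⟨c, hc⟩ (fun g h1 h2 h3 => h.primitive x b (y * c) g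
    (by rw [hc]; ring) h1 (h2.mul_right c) h3)]
  exact S.mul_mem (hx b ⟨y * c, by rw [hc]; ring⟩) (hy b ⟨x * c, by rw [hc]; ring⟩)

theorem classesIn_of_prime_dvd (h : IsImagQuadOrder t n ω) (c : ℕ) (hc : c ≠ 0)
    (hp : ∀ p : ℕ, p.Prime → p ∣ c → ClassesIn t n ω S p) : ClassesIn t n ω S c := by
  induction c using Nat.recOnMul with
  | zero => exact absurd rfl hc
  | one => intro b _; simp [h.formClass_one, S.one_mem]
  | prime p hpp => exact hp p hpp dvd_rfl
  | mul x y ihx ihy =>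
    exact h.classesIn_mul
      (ihx (left_ne_zero_of_mul hc) fun p h1 h2 => hp p h1 (h2.mul_right y))
      (ihy (right_ne_zero_of_mul hc) fun p h1 h2 => hp p h1 (h2.mul_left x))

theorem classesIn_of_root (h : IsImagQuadOrder t n ω) {p : ℕ} (hp : p.Prime) {b : ℤ}
    (hb : (p : ℤ) ∣ quadNorm t n b) (hS : formClass ω p b ∈ S) : ClassesIn t n ω S p := by
  intro x hx
  have hd : (p : ℤ) ∣ (x - b) * (x - (-b - t)) := by
    have : (x - b) * (x - (-b - t)) = quadNorm t n x - quadNorm t n b := by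
      simp only [quadNorm]; ring
    rw [this]
    exact dvd_sub hx hb
  rcases (Nat.prime_iff_prime_int.1 hp).dvd_or_dvd hd with h1 | h1
  · rwa [formClass_congr h1]
  · rw [formClass_congr h1, h.formClass_conj hb]
    exact S.inv_mem hS

/-- Every form is equivalent to one with small leading coefficient. -/
theorem classesIn_of_small_primes (h : IsImagQuadOrder t n ω)
    (hS : ∀ p : ℕ, p.Prime → 3 * (p * p : ℤ) ≤ 4 * n - t * t → ClassesIn t n ω S p)
    (a : ℕ) (ha : a ≠ 0) : ClassesIn t n ω S a := by
  induction a using Nat.strong_induction_on with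
  | _ a ih =>
    refine h.classesIn_of_prime_dvd a ha fun p hp hpa => ?_
    rcases (Nat.le_of_dvd (Nat.pos_of_ne_zero ha) hpa).lt_or_eq with hlt | rfl
    · exact ih p hlt hp.ne_zero
    by_cases hsmall : 3 * (p * p : ℤ) ≤ 4 * n - t * t
    · exact hS p hp hsmall
    intro x hx
    have hp0 : (0 : ℤ) < p := by exact_mod_cast hp.pos
    obtain ⟨b, hb, hb1, hb2⟩ : ∃ b : ℤ, (p : ℤ) ∣ x - b ∧ -(p : ℤ) ≤ 2 * b + t ∧
        2 * b + t ≤ p := by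
      refine ⟨x - p * ((2 * x + t + p) / (2 * p)), ⟨_, sub_sub_cancel _ _⟩, ?_, ?_⟩
      · have := Int.ediv_mul_le (2 * x + t + p) (b := 2 * p) (by omega)
        linarith
      · have := Int.lt_ediv_add_one_mul_self (2 * x + t + p) (b := 2 * p) (by omega)
        linarith
    have hb' : (p : ℤ) ∣ quadNorm t n b := by
      have : quadNorm t n b = quadNorm t n x - (x - b) * (x + b + t) := by
        simp only [quadNorm]; ring
      rw [this]
      exact dvd_sub hx (hb.mul_right _)
    obtain ⟨c, hc⟩ := hb'
    have hpos := h.quadNorm_pos b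
    have hc0 : 0 < c := by
      rw [hc] at hpos
      exact pos_of_mul_pos_right hpos hp0.le
    have hcp : c < p := by
      have e : 4 * (p * c) = (2 * b + t) * (2 * b + t) + (4 * n - t * t) := by
        rw [← hc]; simp only [quadNorm]; ring
      nlinarith
    lift c to ℕ using hc0.le
    rw [formClass_congr hb, h.formClass_swap hp0.ne' hc.symm]
    exact ih c (by exact_mod_cast hcp) (by rintro rfl; simp at hc0) _
      ⟨p, by rw [quadNorm_conj, hc]; ring⟩

end IsImagQuadOrder

/-- A sufficient criterion for `X ^ 2 + t X + n` to have no root modulo the prime `p`. -/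
def noRoot (t n : ℤ) (p : ℕ) : Bool :=
  if p = 2 then n % 2 = 1 && (1 + t + n) % 2 = 1
  else decide (2 ≤ ((t * t - 4 * n) % p).toNat ^ ((p - 1) / 2) % p)

theorem not_dvd_quadNorm_of_noRoot {t n : ℤ} {p : ℕ} (hp : p.Prime) (h : noRoot t n p = true)
    (b : ℤ) : ¬ (p : ℤ) ∣ quadNorm t n b := by
  intro hb
  unfold noRoot at h
  split_ifs at h with h2
  · subst h2
    simp only [Bool.and_eq_true, decide_eq_true_eq] at h
    have h3 : quadNorm t n b % 2 = 0 := Int.emod_eq_zero_of_dvd (by exact_mod_cast hb)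
    rcases Int.even_or_odd' b with ⟨k, rfl | rfl⟩
    · have : quadNorm t n (2 * k) = n + 2 * (2 * k * k + t * k) := by simp only [quadNorm]; ring
      omega
    · have : quadNorm t n (2 * k + 1) = (1 + t + n) + 2 * (2 * k * k + 2 * k + t * k) := by
        simp only [quadNorm]; ring
      omega
  · have := Fact.mk hp
    simp only [decide_eq_true_eq] at h
    set e := ((t * t - 4 * n) % p).toNat ^ ((p - 1) / 2) % p with he
    have hp0 : (0 : ℤ) < p := by exact_mod_cast hp.pos
    have hcast : (e : ZMod p) = ((2 * b + t : ℤ) : ZMod p) ^ (p - 1) := by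
      have h1 : ((t * t - 4 * n : ℤ) : ZMod p) = ((2 * b + t : ℤ) : ZMod p) ^ 2 := by
        have : ((quadNorm t n b : ℤ) : ZMod p) = 0 := (ZMod.intCast_zmod_eq_zero_iff_dvd _ _).2 hb
        simp only [quadNorm] at this
        push_cast at this ⊢
        linear_combination -4 * this
      have h3 : ((((t * t - 4 * n) % p).toNat : ℕ) : ZMod p) = ((t * t - 4 * n : ℤ) : ZMod p) := by
        rw [← Int.cast_natCast, Int.toNat_of_nonneg (Int.emod_nonneg _ hp0.ne'), ZMod.intCast_mod]
      rw [he, ZMod.natCast_mod, Nat.cast_pow, h3, h1, ← pow_mul]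
      congr 1
      have := hp.eq_two_or_odd
      omega
    have he_lt : e < p := Nat.mod_lt _ hp.pos
    by_cases h0 : ((2 * b + t : ℤ) : ZMod p) = 0
    · rw [h0, zero_pow (by have := hp.two_le; omega), ZMod.natCast_eq_zero_iff] at hcast
      have := Nat.le_of_dvd (by omega) hcast
      omega
    · rw [ZMod.pow_card_sub_one_eq_one h0, ← Nat.cast_one, ZMod.natCast_eq_natCast_iff'] at hcast
      rw [Nat.mod_eq_of_lt he_lt, Nat.mod_eq_of_lt (by omega)] at hcast
      omega

/-- Checks that each prime of the list which divides neither `acc` nor exceeds the bound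
`√((4 n - t ^ 2) / 3)` is inert, or has an ideal equivalent to one whose norm is composed of
prime factors of `acc` and previous primes of the list; the list of integers gives these ideals. -/
def smoothCert (t n : ℤ) : ℕ → List ℕ → List ℤ → Bool
  | _, [], _ => true
  | acc, p :: ps, cs =>
    if acc % p = 0 || 4 * n - t * t < 3 * (p * p : ℤ) || noRoot t n p then smoothCert t n acc ps cs
    else match cs with
      | [] => false
      | b :: cs' => quadNorm t n b % p = 0 && acc ^ 24 % (quadNorm t n b / p).toNat = 0 &&
          smoothCert t n (acc * p) ps cs'

theorem IsImagQuadOrder.classesIn_of_smoothCert {O : Type*} [CommRing O] [IsDedekindDomain O]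
    {t n : ℤ} {ω : O} {S : Subgroup (ClassGroup O)} (h : IsImagQuadOrder t n ω) (l : List ℕ) :
    ∀ (acc : ℕ) (cs : List ℤ), (∀ p ∈ l, p.Prime) →
      (∀ q : ℕ, q.Prime → q ∣ acc → ClassesIn t n ω S q) → smoothCert t n acc l cs = true →
      ∀ p ∈ l, 3 * (p * p : ℤ) ≤ 4 * n - t * t → ClassesIn t n ω S p := by
  induction l with
  | nil => simp
  | cons p ps ih =>
    intro acc cs hl hacc hcert
    have hp : p.Prime := hl p (by simp)
    have hp0 : (0 : ℤ) < p := by exact_mod_cast hp.pos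
    have hl' : ∀ q ∈ ps, q.Prime := fun q hq => hl q (by simp [hq])
    unfold smoothCert at hcert
    split_ifs at hcert with hc
    · simp only [Bool.or_eq_true, decide_eq_true_eq] at hc
      intro q hq hqD
      rcases List.mem_cons.1 hq with rfl | hq
      · rcases hc with (hc | hc) | hc
        · exact hacc q hp (Nat.dvd_of_mod_eq_zero hc)
        · omega
        · exact fun b hb => absurd hb (not_dvd_quadNorm_of_noRoot hp hc b)
      · exact ih acc cs hl' hacc hcert q hq hqD
    · cases cs with
      | nil => simp at hcert
      | cons b cs' =>
        simp only [Bool.and_eq_true, decide_eq_true_eq] at hcert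
        obtain ⟨⟨h1, h2⟩, h3⟩ := hcert
        have hgood : ClassesIn t n ω S p := by
          have hb : (p : ℤ) ∣ quadNorm t n b := Int.dvd_of_emod_eq_zero h1
          refine h.classesIn_of_root hp hb ?_
          obtain ⟨c, hc⟩ := hb
          have hpos := h.quadNorm_pos b
          have hc0 : 0 < c := by
            rw [hc] at hpos
            exact pos_of_mul_pos_right hpos hp0.le
          rw [hc, Int.mul_ediv_cancel_left _ hp0.ne'] at h2
          lift c to ℕ using hc0.le
          rw [Int.toNat_natCast] at h2
          rw [h.formClass_swap hp0.ne' hc.symm]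
          refine h.classesIn_of_prime_dvd c (by rintro rfl; simp at hc0) (fun q hq hqc => ?_) _
            ⟨p, by rw [quadNorm_conj, hc]; ring⟩
          exact hacc q hq (hq.dvd_of_dvd_pow (hqc.trans (Nat.dvd_of_mod_eq_zero h2)))
        intro q hq hqD
        rcases List.mem_cons.1 hq with rfl | hq
        · exact hgood
        · refine ih (acc * p) cs' hl' (fun r hr hrd => ?_) h3 q hq hqD
          rcases (Nat.Prime.dvd_mul hr).1 hrd with h4 | h4
          · exact hacc r hr h4
          · rwa [(Nat.prime_dvd_prime_iff_eq hr hp).1 h4]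

/-- The pair `(a, b)` stands for the positive definite form `(a, 2 b + t, c)`. -/
def IsForm (t n : ℤ) (f : ℤ × ℤ) : Prop := 0 < f.1 ∧ f.1 ∣ quadNorm t n f.2

/-- Exchange the outer coefficients of a form. -/
def formSwap (t n : ℤ) (f : ℤ × ℤ) : ℤ × ℤ := (quadNorm t n f.2 / f.1, -f.2 - t)

/-- Make the middle coefficient of a form small. -/
def formCenter (t : ℤ) (f : ℤ × ℤ) : ℤ × ℤ :=
  (f.1, f.2 - f.1 * ((2 * f.2 + t + f.1) / (2 * f.1)))

/-- Gauss reduction of forms. -/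
def formReduce (t n : ℤ) : ℕ → ℤ × ℤ → ℤ × ℤ
  | 0, f => f
  | k + 1, f =>
    if (formSwap t n (formCenter t f)).1 < f.1 then formReduce t n k (formSwap t n (formCenter t f))
    else formCenter t f

/-- Search for an equivalent form whose leading coefficient is prime to `a`. -/
def coprimeForm (t n a : ℤ) : ℕ → ℤ → ℤ × ℤ → ℤ × ℤ
  | 0, _, f => f
  | k + 1, s, f =>
    if Int.gcd a f.1 = 1 then f
    else coprimeForm t n a k (s + 1) (formSwap t n (f.1, f.2 + f.1 * s))

/-- The Euclidean algorithm: `bezoutCoeff k r r' 1 0` is an inverse of `r` modulo `r'`. -/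
def bezoutCoeff : ℕ → ℤ → ℤ → ℤ → ℤ → ℤ
  | 0, _, _, s, _ => s
  | k + 1, r, r', s, s' => if r' = 0 then s else bezoutCoeff k r' (r % r') s' (s - r / r' * s')

/-- Composition of two forms with coprime leading coefficients, given an inverse `u` of the first
leading coefficient modulo the second. -/
def formCompose (t n : ℤ) (f g : ℤ × ℤ) (u : ℤ) : Option (ℤ × ℤ) :=
  if (f.1 * u - 1) % g.1 = 0 then
    some (formReduce t n 60 (f.1 * g.1, f.2 + f.1 * (u * (g.2 - f.2) % g.1)))
  else none

/-- Composition of forms. -/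
def formMul (t n : ℤ) (f g : ℤ × ℤ) : Option (ℤ × ℤ) :=
  formCompose t n f (coprimeForm t n f.1 20 1 g)
    (bezoutCoeff 40 f.1 (coprimeForm t n f.1 20 1 g).1 1 0)

/-- Composition of a list of forms. -/
def formProd (t n : ℤ) : List (ℤ × ℤ) → Option (ℤ × ℤ)
  | [] => some (1, 0)
  | f :: l => (formProd t n l).bind (formMul t n f)

namespace IsImagQuadOrder

variable {O : Type*} [CommRing O] [IsDedekindDomain O] {t n : ℤ} {ω : O}

theorem isForm_swap (h : IsImagQuadOrder t n ω) {f : ℤ × ℤ} (hf : IsForm t n f) :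
    IsForm t n (formSwap t n f) ∧
      formClass ω (formSwap t n f).1 (formSwap t n f).2 = formClass ω f.1 f.2 := by
  obtain ⟨h1, c, hc⟩ := hf
  have hpos := h.quadNorm_pos f.2
  have e : quadNorm t n f.2 / f.1 = c := by rw [hc, Int.mul_ediv_cancel_left _ h1.ne']
  simp only [IsForm, formSwap, e]
  refine ⟨⟨?_, f.1, by rw [quadNorm_conj, hc]; ring⟩, (h.formClass_swap h1.ne' hc.symm).symm⟩
  rw [hc] at hpos
  exact pos_of_mul_pos_right hpos h1.le

theorem isForm_shift {f : ℤ × ℤ} (hf : IsForm t n f) (k : ℤ) :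
    IsForm t n (f.1, f.2 + f.1 * k) ∧ formClass ω f.1 (f.2 + f.1 * k) = formClass ω f.1 f.2 := by
  refine ⟨⟨hf.1, ?_⟩, formClass_congr ⟨k, by ring⟩⟩
  have : quadNorm t n (f.2 + f.1 * k) =
      quadNorm t n f.2 + f.1 * (k * (2 * f.2 + f.1 * k + t)) := by
    simp only [quadNorm]; ring
  simp only [this]
  exact dvd_add hf.2 ⟨_, rfl⟩

theorem isForm_center {f : ℤ × ℤ} (hf : IsForm t n f) :
    IsForm t n (formCenter t f) ∧
      formClass ω (formCenter t f).1 (formCenter t f).2 = formClass ω f.1 f.2 := by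
  have := isForm_shift (ω := ω) hf (-((2 * f.2 + t + f.1) / (2 * f.1)))
  simpa only [formCenter, mul_neg, ← sub_eq_add_neg] using this

theorem isForm_reduce (h : IsImagQuadOrder t n ω) (k : ℕ) : ∀ {f : ℤ × ℤ}, IsForm t n f →
    IsForm t n (formReduce t n k f) ∧
      formClass ω (formReduce t n k f).1 (formReduce t n k f).2 = formClass ω f.1 f.2 := by
  induction k with
  | zero => exact fun hf => ⟨hf, rfl⟩
  | succ k ih =>
    intro f hf
    have h1 := isForm_center (ω := ω) hf
    have h2 := h.isForm_swap h1.1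
    rw [formReduce]
    split_ifs
    · exact ⟨(ih h2.1).1, (ih h2.1).2.trans (h2.2.trans h1.2)⟩
    · exact h1

theorem isForm_coprime (h : IsImagQuadOrder t n ω) (a : ℤ) (k : ℕ) :
    ∀ (s : ℤ) {f : ℤ × ℤ}, IsForm t n f → IsForm t n (coprimeForm t n a k s f) ∧
      formClass ω (coprimeForm t n a k s f).1 (coprimeForm t n a k s f).2 =
        formClass ω f.1 f.2 := by
  induction k with
  | zero => exact fun s f hf => ⟨hf, rfl⟩
  | succ k ih =>
    intro s f hf
    have h1 := isForm_shift (ω := ω) hf s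
    have h2 := h.isForm_swap h1.1
    rw [coprimeForm]
    split_ifs
    · exact ⟨hf, rfl⟩
    · exact ⟨(ih (s + 1) h2.1).1, (ih (s + 1) h2.1).2.trans (h2.2.trans h1.2)⟩

theorem isForm_compose (h : IsImagQuadOrder t n ω) {f g x : ℤ × ℤ} {u : ℤ} (hf : IsForm t n f)
    (hg : IsForm t n g) (hx : formCompose t n f g u = some x) :
    IsForm t n x ∧ formClass ω x.1 x.2 = formClass ω f.1 f.2 * formClass ω g.1 g.2 := by
  unfold formCompose at hx
  split_ifs at hx with hu
  obtain rfl := Option.some.inj hx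
  set b := f.2 + f.1 * (u * (g.2 - f.2) % g.1) with hb
  obtain ⟨v, hv⟩ := Int.dvd_of_emod_eq_zero hu
  have hcop : IsCoprime f.1 g.1 := ⟨u, -v, by linear_combination hv⟩
  have hmod := Int.emod_add_mul_ediv (u * (g.2 - f.2)) g.1
  have hfb := isForm_shift (ω := ω) hf (u * (g.2 - f.2) % g.1)
  have hgb := isForm_shift (ω := ω) hg
    (v * (g.2 - f.2) - f.1 * (u * (g.2 - f.2) / g.1))
  have e : g.2 + g.1 * (v * (g.2 - f.2) - f.1 * (u * (g.2 - f.2) / g.1)) = b := by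
    rw [hb]
    linear_combination -(g.2 - f.2) * hv - f.1 * hmod
  rw [e] at hgb
  rw [← hb] at hfb
  have hd : f.1 * g.1 ∣ quadNorm t n b := hcop.mul_dvd hfb.1.2 hgb.1.2
  have hform : IsForm t n (f.1 * g.1, b) := ⟨mul_pos hf.1 hg.1, hd⟩
  refine ⟨(h.isForm_reduce 60 hform).1, (h.isForm_reduce 60 hform).2.trans ?_⟩
  rw [← hfb.2, ← hgb.2]
  exact (h.formClass_mul hd fun d h1 h2 _ => hcop.isUnit_of_dvd' h1 h2).symm

theorem isForm_mul (h : IsImagQuadOrder t n ω) {f g x : ℤ × ℤ} (hf : IsForm t n f)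
    (hg : IsForm t n g) (hx : formMul t n f g = some x) :
    IsForm t n x ∧ formClass ω x.1 x.2 = formClass ω f.1 f.2 * formClass ω g.1 g.2 := by
  have h1 := h.isForm_coprime f.1 20 1 hg
  rw [← h1.2]
  exact h.isForm_compose hf h1.1 hx

theorem isForm_prod (h : IsImagQuadOrder t n ω) (l : List (ℤ × ℤ)) :
    ∀ {x : ℤ × ℤ}, (∀ f ∈ l, IsForm t n f) → formProd t n l = some x →
    IsForm t n x ∧ formClass ω x.1 x.2 = (l.map fun f => formClass ω f.1 f.2).prod := by
  induction l with
  | nil =>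
    intro x _ hx
    obtain rfl := Option.some.inj hx
    exact ⟨⟨one_pos, one_dvd _⟩, by simp [h.formClass_one]⟩
  | cons f l ih =>
    intro x hl hx
    obtain ⟨y, hy, hxy⟩ := Option.bind_eq_some_iff.1 hx
    have h1 := ih (fun g hg => hl g (by simp [hg])) hy
    have h2 := h.isForm_mul (hl f (by simp)) h1.1 hxy
    exact ⟨h2.1, by rw [h2.2, h1.2, List.map_cons, List.prod_cons]⟩

end IsImagQuadOrder

/-- The primes below `761`. -/
def smallPrimes : List ℕ :=
    [2, 3, 5, 7, 11, 13, 17, 19, 23, 29, 31, 37, 41, 43, 47, 53, 59, 61, 67, 71, 73, 79, 83, 89,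
    97, 101, 103, 107, 109, 113, 127, 131, 137, 139, 149, 151, 157, 163, 167, 173, 179, 181,
    191, 193, 197, 199, 211, 223, 227, 229, 233, 239, 241, 251, 257, 263, 269, 271, 277, 281,
    283, 293, 307, 311, 313, 317, 331, 337, 347, 349, 353, 359, 367, 373, 379, 383, 389, 397,
    401, 409, 419, 421, 431, 433, 439, 443, 449, 457, 461, 463, 467, 479, 487, 491, 499, 503,
    509, 521, 523, 541, 547, 557, 563, 569, 571, 577, 587, 593, 599, 601, 607, 613, 617, 619,
    631, 641, 643, 647, 653, 659, 661, 673, 677, 683, 691, 701, 709, 719, 727, 733, 739, 743,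
    751, 757]

theorem mem_smallPrimes {p : ℕ} (hp : p < 761) : p ∈ smallPrimes ↔ p.Prime := by
  have key : ∀ p < 761, p ∈ smallPrimes ↔ 2 ≤ p ∧ ∀ q < 28, 2 ≤ q → q ∣ p → p = q := by
    decide +kernel
  rw [key p hp]
  constructor
  · rintro ⟨h2, h⟩
    by_contra hnp
    have hsq := Nat.minFac_sq_le_self (by omega : 0 < p) hnp
    have hlt : p.minFac < 28 := by nlinarith
    have hpr := Nat.minFac_prime (by omega : p ≠ 1)
    rw [← h p.minFac hlt hpr.two_le (Nat.minFac_dvd p)] at hpr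
    exact hnp hpr
  · exact fun h => ⟨h.two_le, fun q _ hq hqp =>
      ((Nat.dvd_prime h).1 hqp).elim (fun e => by omega) Eq.symm⟩

/-- Numerical verification that a product of forms is principal. -/
def isTrivialProd (t n : ℤ) (l : List (ℤ × ℤ)) : Bool :=
  match formProd t n l with
  | none => false
  | some f => f.1 = 1

/-- Numerical verification that a product of forms is not principal. -/
def isNontrivialProd (t n : ℤ) (l : List (ℤ × ℤ)) : Bool :=
  match formProd t n l with
  | none => false
  | some f => 1 < f.1 && 4 * f.1 < 4 * n - t * t

instance (t n : ℤ) (f : ℤ × ℤ) : Decidable (IsForm t n f) :=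
  inferInstanceAs (Decidable (0 < f.1 ∧ f.1 ∣ quadNorm t n f.2))

/-- Numerical verification that the forms `A` and `B` generate a subgroup isomorphic to `C₉ × C₃`
containing all `m`-th powers of classes. The list `base` consists of quadruples `(p, b, i, j)` such
that the `m`-th power of the form `(p, b)` times `A ^ i * B ^ j` is principal; together with the
certificate `cs` these forms generate the class group. -/
def classCert (t n : ℤ) (m : ℕ) (A B : ℤ × ℤ) (base : List (ℕ × ℤ × ℕ × ℕ)) (cs : List ℤ) : Bool :=
  m % 3 ≠ 0 && 4 * n - t * t < 3 * (761 * 761) && IsForm t n A && IsForm t n B &&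
  isTrivialProd t n (List.replicate 9 A) && isTrivialProd t n (List.replicate 3 B) &&
  isNontrivialProd t n (List.replicate 3 A) && isNontrivialProd t n [B] &&
  isNontrivialProd t n (List.replicate 3 A ++ [B]) &&
  isNontrivialProd t n (List.replicate 3 A ++ [B, B]) &&
  base.all (fun x => x.1 ∈ smallPrimes && IsForm t n (x.1, x.2.1) &&
    isTrivialProd t n (List.replicate m ((x.1 : ℤ), x.2.1) ++
      (List.replicate x.2.2.1 A ++ List.replicate x.2.2.2 B))) &&
  smoothCert t n (base.map Prod.fst).prod smallPrimes cs

theorem prime_of_mem_smallPrimes {p : ℕ} (hp : p ∈ smallPrimes) : p.Prime := by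
  have key : ∀ p ∈ smallPrimes, p < 761 := by decide +kernel
  exact (mem_smallPrimes (key p hp)).1 hp

namespace IsImagQuadOrder

variable {O : Type*} [CommRing O] [IsDedekindDomain O] {t n : ℤ} {ω : O}

theorem prod_eq_one (h : IsImagQuadOrder t n ω) {l : List (ℤ × ℤ)} (hl : ∀ f ∈ l, IsForm t n f)
    (hcert : isTrivialProd t n l = true) : (l.map fun f => formClass ω f.1 f.2).prod = 1 := by
  unfold isTrivialProd at hcert
  split at hcert
  · simp at hcert
  · next f hf =>
    have h1 : f.1 = 1 := by simpa using hcert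
    rw [← (h.isForm_prod l hl hf).2, h1, h.formClass_one]

theorem prod_ne_one (h : IsImagQuadOrder t n ω) {l : List (ℤ × ℤ)} (hl : ∀ f ∈ l, IsForm t n f)
    (hcert : isNontrivialProd t n l = true) :
    (l.map fun f => formClass ω f.1 f.2).prod ≠ 1 := by
  unfold isNontrivialProd at hcert
  split at hcert
  · simp at hcert
  · next f hf =>
    simp only [Bool.and_eq_true, decide_eq_true_eq] at hcert
    have h1 := h.isForm_prod l hl hf
    rw [← h1.2]
    exact h.formClass_ne_one hcert.1 hcert.2 h1.1.2

end IsImagQuadOrder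

theorem nine_nsmul_eq_zero : ∀ z : ZMod 9 × ZMod 3, 9 • z = 0 := by
  decide

theorem sylow_equiv_of_generators {G : Type*} [CommGroup G] {m : ℕ} (hm : m % 3 ≠ 0)
    (φ : Multiplicative (ZMod 9 × ZMod 3) →* G)
    (hφ : Function.Injective φ) (hall : ∀ x : G, x ^ m ∈ φ.range) (P : Sylow 3 G) :
    Nonempty (↥P ≃* Multiplicative (ZMod 9 × ZMod 3)) := by
  have : Fact (Nat.Prime 3) := ⟨by norm_num⟩
  have h9 : ∀ x ∈ φ.range, x ^ 9 = 1 := by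
    rintro _ ⟨y, rfl⟩
    rw [← map_pow]
    have : y ^ 9 = 1 := nine_nsmul_eq_zero y.toAdd
    rw [this, map_one]
  have hrange : IsPGroup 3 φ.range := fun x => ⟨2, Subtype.ext (by simpa using h9 x x.2)⟩
  have hle : (P : Subgroup G) ≤ φ.range := by
    intro x hx
    obtain ⟨k, hk⟩ := P.isPGroup' ⟨x, hx⟩
    have hk' : x ^ 3 ^ k = 1 := by simpa using congrArg Subtype.val hk
    have hcop : Nat.Coprime (3 ^ k) m :=
      Nat.Coprime.pow_left k ((Nat.Prime.coprime_iff_not_dvd (by norm_num)).2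
        fun h => hm (Nat.mod_eq_zero_of_dvd h))
    have hb := Nat.gcd_eq_gcd_ab (3 ^ k) m
    rw [hcop.gcd_eq_one] at hb
    have : x = (x ^ m) ^ (Nat.gcdB (3 ^ k) m) := by
      calc x = x ^ ((1 : ℕ) : ℤ) := by simp
        _ = _ := by
          rw [hb, zpow_add, zpow_mul, zpow_mul, zpow_natCast, zpow_natCast, hk', one_zpow, one_mul]
    rw [this]
    exact Subgroup.zpow_mem _ (hall x) _
  have heq : (P : Subgroup G) = φ.range := (P.is_maximal' hrange hle).symm
  exact ⟨(MulEquiv.subgroupCongr heq).trans (MonoidHom.ofInjective hφ).symm⟩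

theorem exists_hom_of_orders {G : Type*} [CommGroup G] {A B : G} (hA : A ^ 9 = 1) (hB : B ^ 3 = 1)
    (h1 : A ^ 3 ≠ 1) (h2 : B ≠ 1) (h3 : A ^ 3 * B ≠ 1) (h4 : A ^ 3 * (B * B) ≠ 1) :
    ∃ φ : Multiplicative (ZMod 9 × ZMod 3) →* G, Function.Injective φ ∧
      ∀ i j : ℕ, A ^ i * B ^ j ∈ φ.range := by
  have hA' : ((9 : ℕ) : ℤ) • Additive.ofMul A = 0 := by
    rw [natCast_zsmul]; exact congrArg Additive.ofMul hA
  have hB' : ((3 : ℕ) : ℤ) • Additive.ofMul B = 0 := by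
    rw [natCast_zsmul]; exact congrArg Additive.ofMul hB
  let f : ZMod 9 →+ Additive G :=
    ZMod.lift 9 ⟨zmultiplesHom (Additive G) (Additive.ofMul A), hA'⟩
  let g : ZMod 3 →+ Additive G :=
    ZMod.lift 3 ⟨zmultiplesHom (Additive G) (Additive.ofMul B), hB'⟩
  have hf : ∀ i : ℕ, f i = Additive.ofMul (A ^ i) := fun i => by
    have := ZMod.lift_coe 9 ⟨zmultiplesHom (Additive G) (Additive.ofMul A), hA'⟩ (i : ℤ)
    simpa [zmultiplesHom_apply] using this
  have hg : ∀ i : ℕ, g i = Additive.ofMul (B ^ i) := fun i => by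
    have := ZMod.lift_coe 3 ⟨zmultiplesHom (Additive G) (Additive.ofMul B), hB'⟩ (i : ℤ)
    simpa [zmultiplesHom_apply] using this
  let ψ : ZMod 9 × ZMod 3 →+ Additive G := f.coprod g
  have hψ : ∀ i j : ℕ, ψ (i, j) = Additive.ofMul (A ^ i * B ^ j) := fun i j => by
    rw [AddMonoidHom.coprod_apply, hf, hg, ofMul_mul]
  refine ⟨AddMonoidHom.toMultiplicativeLeft ψ, ?_, fun i j => ⟨Multiplicative.ofAdd (i, j), ?_⟩⟩
  · have hinj : ∀ x, ψ x = 0 → x = 0 := by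
      intro x hx
      by_contra hx0
      have key : ∀ x : ZMod 9 × ZMod 3, x ≠ 0 → ∃ k < 9, k • x = (3, 0) ∨ k • x = (0, 1) ∨
          k • x = (3, 1) ∨ k • x = (3, 2) := by decide
      obtain ⟨k, -, hk⟩ := key x hx0
      have hkx : ψ (k • x) = 0 := by rw [map_nsmul, hx, nsmul_zero]
      have hone : ∀ i j : ℕ, ψ (i, j) = 0 → A ^ i * B ^ j = 1 := fun i j hij =>
        Additive.ofMul.injective ((hψ i j).symm.trans hij)
      rcases hk with hk | hk | hk | hk <;> rw [hk] at hkx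
      · exact h1 (by simpa using hone 3 0 (by simpa using hkx))
      · exact h2 (by simpa using hone 0 1 (by simpa using hkx))
      · exact h3 (by simpa using hone 3 1 (by simpa using hkx))
      · exact h4 (by simpa [pow_two] using hone 3 2 (by simpa using hkx))
    exact (injective_iff_map_eq_one _).2 fun x hx => hinj x.toAdd hx
  · exact hψ i j

/-- Numerical verification that an integer in `[1, 2250000)` is squarefree. -/
def squarefreeCert (s : ℤ) : Bool :=
  0 < s && s < 1500 * 1500 && (List.range 1500).all fun k => k ≤ 1 || s.toNat % (k * k) ≠ 0

theorem squarefree_of_cert {s : ℤ} (h : squarefreeCert s = true) : Squarefree s := by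
  simp only [squarefreeCert, Bool.and_eq_true, decide_eq_true_eq, List.all_eq_true,
    List.mem_range, Bool.or_eq_true] at h
  obtain ⟨⟨h0, h1⟩, h2⟩ := h
  rw [← Int.squarefree_natAbs]
  intro x hx
  have hle := Nat.le_of_dvd (by omega) hx
  have hlt : x < 1500 := by
    by_contra hge
    have : 1500 * 1500 ≤ x * x := Nat.mul_le_mul (by omega) (by omega)
    omega
  rw [Nat.isUnit_iff]
  rcases h2 x hlt with h3 | h3
  · interval_cases x
    · simp at hx; omega
    · rfl
  · have e : s.toNat = s.natAbs := by omega
    rw [e] at h3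
    exact absurd (Nat.mod_eq_zero_of_dvd hx) h3

/-- The integer `t ^ 2 - 4 n` is a negative fundamental discriminant. -/
def IsFundamental (t n : ℤ) : Prop :=
  (t = 1 ∧ 0 < n ∧ Squarefree (4 * n - 1)) ∨
    (t = 0 ∧ 0 < n ∧ (n % 4 = 1 ∨ n % 4 = 2) ∧ Squarefree n)

theorem IsFundamental.primitive {t n : ℤ} (h : IsFundamental t n) {a b c g : ℤ}
    (e : a * c = quadNorm t n b) (ha : g ∣ a) (hc : g ∣ c) (hb : g ∣ 2 * b + t) : IsUnit g := by
  have hD : g * g ∣ 4 * n - t * t := by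
    have : 4 * n - t * t = 4 * (a * c) - (2 * b + t) * (2 * b + t) := by
      rw [e]; simp only [quadNorm]; ring
    rw [this]
    exact dvd_sub ((mul_dvd_mul ha hc).mul_left 4) (mul_dvd_mul hb hb)
  rcases h with ⟨rfl, -, hs⟩ | ⟨rfl, -, hn, hs⟩
  · exact hs g (by simpa using hD)
  · have h2 : ¬ (2 : ℤ) ∣ g := by
      intro h2
      obtain ⟨k, hk⟩ := mul_dvd_mul (h2.trans ha) (h2.trans hc)
      rw [e] at hk
      simp only [quadNorm] at hk
      rcases Int.even_or_odd' b with ⟨l, rfl | rfl⟩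
      · have : 2 * l * (2 * l) = 4 * (l * l) := by ring
        omega
      · have : (2 * l + 1) * (2 * l + 1) = 4 * (l * l + l) + 1 := by ring
        omega
    have hcop : IsCoprime (g * g) (4 : ℤ) := by
      have : IsCoprime g 2 := ((Int.prime_two.coprime_iff_not_dvd).2 h2).symm
      exact (this.mul_left this).mul_right (this.mul_left this)
    refine hs g (hcop.dvd_of_dvd_mul_left ?_)
    simpa using hD

theorem exists_intCast_of_squarefree {s k : ℤ} (hs : Squarefree s) {q : ℚ}
    (h : (s : ℚ) * (q * q) = k) : ∃ z : ℤ, q = z := by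
  have hd : (q.den : ℤ) * q.den ∣ s := by
    have e : s * (q.num * q.num) = k * (q.den * q.den) := by
      have hq := Rat.num_div_den q
      have h0 : (q.den : ℚ) ≠ 0 := by exact_mod_cast q.den_nz
      rw [← hq] at h
      field_simp at h
      have : (s : ℚ) * (q.num * q.num) = k * (q.den * q.den) := by linear_combination h
      exact_mod_cast this
    have hcop : IsCoprime (q.den : ℤ) q.num := by
      rw [Int.isCoprime_iff_gcd_eq_one, Int.gcd_comm]
      exact q.reduced
    exact ((hcop.mul_left hcop).mul_right (hcop.mul_left hcop)).dvd_of_dvd_mul_right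
      ⟨k, by rw [e]; ring⟩
  have h1 := hs _ hd
  rw [Int.ofNat_isUnit, Nat.isUnit_iff] at h1
  exact ⟨q.num, (Rat.den_eq_one_iff q).1 h1 |>.symm⟩

theorem trace_norm_of_sq_eq {K : Type*} [Field K] [NumberField K]
    (hK : Module.finrank ℚ K = 2) {d : ℤ} {α : K} (hα : α ^ 2 = d)
    (hlin : ∀ p q : ℚ, (p : K) + q * α = 0 → p = 0 ∧ q = 0) (x : K) :
    ∃ p q : ℚ, x = p + q * α ∧ Algebra.trace ℚ K x = 2 * p ∧
      Algebra.norm ℚ x = p * p - d * (q * q) := by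
  have hli : LinearIndependent ℚ ![(1 : K), α] := by
    rw [LinearIndependent.pair_iff]
    intro p q hpq
    exact hlin p q (by simpa [Algebra.smul_def] using hpq)
  let b := basisOfLinearIndependentOfCardEqFinrank hli (by simp [hK])
  have hb0 : b 0 = 1 := by simp [b]
  have hb1 : b 1 = α := by simp [b]
  have hrepr : ∀ p q : ℚ, b.repr ((p : K) + q * α) 0 = p ∧ b.repr ((p : K) + q * α) 1 = q := by
    intro p q
    have : (p : K) + q * α = p • b 0 + q • b 1 := by
      rw [hb0, hb1]; simp [Algebra.smul_def]
    rw [this]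
    simp
  obtain ⟨p, q, rfl⟩ : ∃ p q : ℚ, x = p + q * α := by
    refine ⟨b.repr x 0, b.repr x 1, ?_⟩
    have := b.sum_repr x
    rw [Fin.sum_univ_two, hb0, hb1] at this
    simpa [Algebra.smul_def] using this.symm
  refine ⟨p, q, rfl, ?_⟩
  have e0 : ((p : K) + q * α) * b 0 = p + q * α := by rw [hb0, mul_one]
  have e1 : ((p : K) + q * α) * b 1 = ((d * q : ℚ) : K) + p * α := by
    rw [hb1]; push_cast; linear_combination (q : K) * hα
  rw [Algebra.trace_eq_matrix_trace b, Algebra.norm_eq_matrix_det b, Matrix.trace_fin_two,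
    Matrix.det_fin_two]
  simp only [Algebra.leftMulMatrix_eq_repr_mul, e0, e1, hrepr]
  exact ⟨by ring, by ring⟩

theorem exists_isImagQuadOrder {K : Type*} [Field K] [NumberField K]
    (hK : Module.finrank ℚ K = 2) {t n d : ℤ} (hf : IsFundamental t n) (hd : d = t * t - 4 * n)
    {α : K} (hα : α ^ 2 = d) :
    ∃ ω : NumberField.RingOfIntegers K, IsImagQuadOrder t n ω := by
  have hneg : t * t < 4 * n := by
    rcases hf with ⟨rfl, h, -⟩ | ⟨rfl, h, -⟩ <;> omega
  have hlin : ∀ p q : ℚ, (p : K) + q * α = 0 → p = 0 ∧ q = 0 := by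
    intro p q h
    have hpq : p * p = d * (q * q) := by
      have : ((p * p : ℚ) : K) = ((d * (q * q) : ℚ) : K) := by
        push_cast
        linear_combination ((p : K) - q * α) * h + (q : K) * q * hα
      exact_mod_cast this
    have hd' : (d : ℚ) < 0 := by exact_mod_cast (by omega : d < 0)
    have hq : q = 0 := by
      by_contra hq
      have : 0 < q * q := mul_self_pos.2 hq
      nlinarith [mul_self_nonneg p]
    subst hq
    exact ⟨by simpa using hpq, rfl⟩
  have hdK : α ^ 2 = (t : K) * t - 4 * n := by rw [hα, hd]; push_cast; ring
  have hint : IsIntegral ℤ (((t : K) + α) / 2) := by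
    refine ⟨Polynomial.X ^ 2 - Polynomial.C t * Polynomial.X + Polynomial.C n, by monicity!, ?_⟩
    simp only [Polynomial.eval₂_add, Polynomial.eval₂_sub, Polynomial.eval₂_mul,
      Polynomial.eval₂_pow, Polynomial.eval₂_X, Polynomial.eval₂_C]
    simp only [eq_intCast]
    linear_combination hdK / 4
  obtain ⟨ω, hω⟩ : ∃ ω : NumberField.RingOfIntegers K,
      algebraMap (NumberField.RingOfIntegers K) K ω = (t + α) / 2 := ⟨⟨_, hint⟩, rfl⟩
  refine ⟨ω, ⟨?_, ?_, ?_, hneg, fun a b c g => hf.primitive⟩⟩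
  · apply NumberField.RingOfIntegers.ext
    simp only [map_mul, map_sub, map_intCast, hω]
    linear_combination hdK / 4
  · intro x
    obtain ⟨p, q, hx, htr, hno⟩ := trace_norm_of_sq_eq hK hα hlin (x : K)
    obtain ⟨P, hP⟩ := IsIntegrallyClosed.isIntegral_iff.1
      (Algebra.isIntegral_trace (L := ℚ) (NumberField.RingOfIntegers.isIntegral_coe x))
    obtain ⟨M, hM⟩ := IsIntegrallyClosed.isIntegral_iff.1
      (Algebra.isIntegral_norm ℚ (NumberField.RingOfIntegers.isIntegral_coe x))
    rw [htr] at hP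
    rw [hno] at hM
    simp only [eq_intCast] at hP hM
    suffices ∃ u v : ℤ, (p : ℚ) = u + v * t / 2 ∧ q = v / 2 by
      obtain ⟨u, v, rfl, rfl⟩ := this
      refine ⟨u, v, NumberField.RingOfIntegers.ext ?_⟩
      simp only [hx, map_mul, map_add, map_intCast, hω]
      push_cast
      ring
    have hdQ : (d : ℚ) = t * t - 4 * n := by exact_mod_cast hd
    rcases hf with ⟨rfl, -, hs⟩ | ⟨rfl, -, hn, hs⟩
    · obtain ⟨v, hv⟩ := exists_intCast_of_squarefree (k := 4 * M - P * P) (q := 2 * q) hs (by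
        push_cast
        rw [hP, hM, hdQ]
        push_cast
        ring)
      have hq : q = v / 2 := by linarith
      have hp : p = P / 2 := by linarith
      have e : P * P - (1 - 4 * n) * (v * v) = 4 * M := by
        have : (P : ℚ) * P - (1 - 4 * n) * (v * v) = 4 * M := by
          rw [hM, hdQ, hq, hp]; push_cast; ring
        exact_mod_cast this
      have hpar : (2 : ℤ) ∣ P - v := by
        have h4 : (P - v) * (P + v) = 2 * (2 * M - 2 * n * (v * v)) := by linear_combination e
        rcases Int.prime_two.dvd_or_dvd ⟨_, h4⟩ with h | h <;> omega
      obtain ⟨u, hu⟩ := hpar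
      refine ⟨u, v, ?_, hq⟩
      have : (P : ℚ) - v = 2 * u := by exact_mod_cast hu
      rw [hp]; push_cast; linarith
    · obtain ⟨v, hv⟩ := exists_intCast_of_squarefree (k := 4 * M - P * P) (q := 2 * (2 * q)) hs (by
        push_cast
        rw [hP, hM, hdQ]
        push_cast
        ring)
      have hq : q = v / 4 := by linarith
      have hp : p = P / 2 := by linarith
      have e : P * P + n * (v * v) = 4 * M := by
        have : (P : ℚ) * P + n * (v * v) = 4 * M := by
          rw [hM, hdQ, hq, hp]; push_cast; ring
        exact_mod_cast this
      have hpar : ∃ k l : ℤ, P = 2 * k ∧ v = 2 * l := by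
        rcases Int.even_or_odd' P with ⟨k, rfl | rfl⟩ <;>
          rcases Int.even_or_odd' v with ⟨l, rfl | rfl⟩
        · exact ⟨k, l, rfl, rfl⟩
        · have : 2 * k * (2 * k) + n * ((2 * l + 1) * (2 * l + 1)) =
            n + 4 * (k * k + n * (l * l + l)) := by ring
          omega
        · have : (2 * k + 1) * (2 * k + 1) + n * (2 * l * (2 * l)) =
            1 + 4 * (k * k + k + n * (l * l)) := by ring
          omega
        · have : (2 * k + 1) * (2 * k + 1) + n * ((2 * l + 1) * (2 * l + 1)) =
            1 + n + 4 * (k * k + k + n * (l * l + l)) := by ring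
          omega
      obtain ⟨k, l, rfl, rfl⟩ := hpar
      refine ⟨k, l, ?_, ?_⟩
      · rw [hp]; push_cast; ring
      · rw [hq]; push_cast; ring
  · intro u v huv
    have e : (u : K) + v * ((t + α) / 2) = 0 := by
      simpa only [map_mul, map_add, map_intCast, map_zero, hω] using
        congrArg (algebraMap (NumberField.RingOfIntegers K) K) huv
    obtain ⟨h1, h2⟩ := hlin (u + v * t / 2) (v / 2) (by push_cast; linear_combination e)
    have hv : (v : ℚ) = 0 := by linarith
    rw [hv] at h1
    exact ⟨by simpa using h1, by exact_mod_cast hv⟩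

/-- The numerical certificate determines the 3-class group. -/
theorem sylow_equiv_of_classCert {K : Type*} [Field K] [NumberField K]
    (hK : Module.finrank ℚ K = 2) {d : ℤ} (hα : ∃ α : K, α ^ 2 = (d : K)) {t n : ℤ}
    {m : ℕ} {A B : ℤ × ℤ} {base : List (ℕ × ℤ × ℕ × ℕ)} {cs : List ℤ}
    (hcert : classCert t n m A B base cs = true) (hf : IsFundamental t n)
    (hd : d = t * t - 4 * n) (P : Sylow 3 (ClassGroup (NumberField.RingOfIntegers K))) :
    Nonempty (↥P ≃* Multiplicative (ZMod 9 × ZMod 3)) := by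
  obtain ⟨α, hα⟩ := hα
  obtain ⟨ω, h⟩ := exists_isImagQuadOrder hK hf hd hα
  simp only [classCert, Bool.and_eq_true, decide_eq_true_eq, List.all_eq_true] at hcert
  obtain ⟨⟨⟨⟨⟨⟨⟨⟨⟨⟨⟨hm, hbound⟩, hA⟩, hB⟩, hA9⟩, hB3⟩, hn1⟩, hn2⟩, hn3⟩, hn4⟩, hbase⟩, hsmooth⟩ :=
    hcert
  set a := formClass ω A.1 A.2 with ha
  set b := formClass ω B.1 B.2 with hb
  have key1 : a ^ 9 = 1 := by
    simpa only [List.map_append, List.map_replicate, List.prod_append, List.prod_replicate,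
      List.map_cons, List.map_nil, List.prod_cons, List.prod_nil, mul_one] using h.prod_eq_one (by simp [hA]) hA9
  have key2 : b ^ 3 = 1 := by
    simpa only [List.map_append, List.map_replicate, List.prod_append, List.prod_replicate,
      List.map_cons, List.map_nil, List.prod_cons, List.prod_nil, mul_one] using h.prod_eq_one (by simp [hB]) hB3
  have key3 : a ^ 3 ≠ 1 := by
    simpa only [List.map_append, List.map_replicate, List.prod_append, List.prod_replicate,
      List.map_cons, List.map_nil, List.prod_cons, List.prod_nil, mul_one] using h.prod_ne_one (by simp [hA]) hn1
  have key4 : b ≠ 1 := by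
    simpa using h.prod_ne_one (by simp [hB]) hn2
  have key5 : a ^ 3 * b ≠ 1 := by
    simpa only [List.map_append, List.map_replicate, List.prod_append, List.prod_replicate,
      List.map_cons, List.map_nil, List.prod_cons, List.prod_nil, mul_one] using h.prod_ne_one (by simp [or_imp, forall_and, hA, hB]) hn3
  have key6 : a ^ 3 * (b * b) ≠ 1 := by
    simpa only [List.map_append, List.map_replicate, List.prod_append, List.prod_replicate,
      List.map_cons, List.map_nil, List.prod_cons, List.prod_nil, mul_one] using h.prod_ne_one (by simp [or_imp, forall_and, hA, hB]) hn4
  obtain ⟨φ, hφ, hmem⟩ := exists_hom_of_orders key1 key2 key3 key4 key5 key6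
  refine sylow_equiv_of_generators hm φ hφ (fun x => ?_) P
  let S := φ.range.comap (powMonoidHom m)
  have hprime : ∀ x ∈ base, x.1.Prime := fun x hx =>
    prime_of_mem_smallPrimes (hbase x hx).1.1
  have hbaseS : ∀ q : ℕ, q.Prime → q ∣ (base.map Prod.fst).prod → ClassesIn t n ω S q := by
    intro q hq hqd
    obtain ⟨y, hy, hqy⟩ := (Nat.prime_iff.1 hq).dvd_prod_iff.1 hqd
    obtain ⟨x, hx, rfl⟩ := List.mem_map.1 hy
    rw [(Nat.prime_dvd_prime_iff_eq hq (hprime x hx)).1 hqy]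
    obtain ⟨⟨-, hxf⟩, hxt⟩ := hbase x hx
    refine h.classesIn_of_root (hprime x hx) hxf.2 ?_
    have := h.prod_eq_one (by simp +contextual [or_imp, hA, hB, hxf]) hxt
    simp only [List.map_append, List.map_replicate, List.prod_append, List.prod_replicate] at this
    change formClass ω x.1 x.2.1 ^ m ∈ φ.range
    rw [eq_inv_of_mul_eq_one_left this]
    exact Subgroup.inv_mem _ (hmem _ _)
  have hsmall := h.classesIn_of_smoothCert smallPrimes _ cs
    (fun p hp => prime_of_mem_smallPrimes hp) hbaseS hsmooth
  have hall := h.classesIn_of_small_primes (S := S) fun p hp hpD =>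
    hsmall p ((mem_smallPrimes (by
      have : (p : ℤ) * p < 761 * 761 := by linarith
      have : (p : ℤ) < 761 := by nlinarith
      exact_mod_cast this)).2 hp) hpD
  obtain ⟨a', b', ha', hd', rfl⟩ := h.exists_formClass x
  lift a' to ℕ using ha'.le
  exact hall a' (by rintro rfl; simp at ha') b' hd'

theorem isFundamental_of_cert_one {n : ℤ} (h : squarefreeCert (4 * n - 1) = true) :
    IsFundamental 1 n := by
  refine Or.inl ⟨rfl, ?_, squarefree_of_cert h⟩
  simp only [squarefreeCert, Bool.and_eq_true, decide_eq_true_eq] at h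
  omega

theorem isFundamental_of_cert_zero {n : ℤ} (h : squarefreeCert n = true)
    (hn : n % 4 = 1 ∨ n % 4 = 2) : IsFundamental 0 n := by
  refine Or.inr ⟨rfl, ?_, hn, squarefree_of_cert h⟩
  simp only [squarefreeCert, Bool.and_eq_true, decide_eq_true_eq] at h
  omega

theorem classCert_neg1103784 : classCert 0 275946 2 (25, -2) (411, -66)
    [(2, 0, 0, 0), (3, 0, 0, 0), (5, 2, 1, 0), (7, 1, 8, 2), (11, 0, 0, 0)]
    [330, -13, -27, -148, -36, -48, 33, -78, 102, 118, 0, 5, 66, -160, 7, -341, -120, -122,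
    -208, 92, 64, 107, 103, 97, 106, 53, 71, 143, 10, 22, -248, 194, 151, 183, 87, 203, 84, 1,
    -438, 21, -312, 17, 65, 62, 166, 231, 209] = true := by
  decide +kernel

theorem classCert_neg1356215 : classCert 1 339054 20 (91, -4) (240, -18)
    [(2, 0, 6, 2), (3, 0, 3, 2), (13, 3, 2, 0)]
    [462, 1137, -186, 3, -50, 14, 66, 77, 17, 138, -69, -88, 45, 39, 19, 75, -178, 6, -148, 31,
    94, 27, -145, 52, 63, 81, 122, 111, 15, 65, 57, 23, 61, 106, 129, 47, 33, 164, 188, 16, 80,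
    210, 205, 216, 72, 44, 211, 153, 257, 126, 83, 37, 272, 281, 202, 246, 259, 140, 134, 22,
    85] = true := by
  decide +kernel

theorem classCert_neg518835 : classCert 1 129709 2 (19, -7) (109, -11)
    [(3, 1, 0, 0), (5, 2, 0, 0), (19, 6, 2, 0), (29, 13, 5, 2), (37, 16, 7, 1)]
    [622, -362, 253, -70, -393, -317, 272, -89, -132, 723, 337, 1057, 651, 257, 7, 58, -168,
    -458, 44, -137, 127, 27, 122, -284, -503, -287, 28, 109, 87, 151, 403, 187, 56, 46, 10] =
    true := by
  decide +kernel

theorem classCert_neg761855 : classCert 1 190464 22 (26, -4) (254, -40)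
    [(2, 0, 8, 0), (3, 0, 8, 1), (5, 2, 0, 0), (7, 2, 8, 1)]
    [-96, 172, 212, -33, 42, 0, 3, 18, 25, -45, 48, 14, 22, 39, 16, 15, 68, -125, 13, 31, 67,
    26, 29, 72, 61, 79, 69, 71, 99, 90, 73, 54, 59, 116, 9, 12, 74, 139, 80, 23, 187, 129, 66,
    24, 198, 7, 136, 119, 98, 8, 84, 178] = true := by
  decide +kernel

theorem classCert_neg553807 : classCert 1 138452 10 (32, -4) (74, -2)
    [(2, 0, 7, 0), (19, 4, 8, 2)]
    [-29, 3548, -148, -628, 260, -97, 23, -39, 22, -40, -63, 14, 137, 109, -68, 44, -84, -132,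
    213, 36, -116, 61, 63, 90, 108, 130, 399, 124, 138, 76, 43, 104, 64, 176, 103, 46] = true :=
    by
  decide +kernel

theorem classCert_neg763972 : classCert 0 190993 2 (49, -3) (169, -22)
    [(2, 1, 0, 0), (7, 3, 1, 0), (11, 0, 0, 0), (13, 4, 0, 2), (17, 6, 3, 1)]
    [-550, -147, 407, 66, -52, 11, 1, -291, 22, -165, 53, 23, 56, -144, 320, 62, 243, 80, 0, 18,
    57, -330, -157, 82, 260, -230, 321, 360, -173, 109, 89, 27, 73, 152, 28, 19, -235, 205, 113,
    221, 145, 59, 110, 115] = true := by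
  decide +kernel

theorem classCert_neg876948 : classCert 0 219237 4 (33, -9) (177, -78)
    [(2, 1, 0, 0), (3, 0, 0, 0), (11, 2, 5, 0), (19, 2, 4, 0), (37, 5, 3, 2), (41, 20, 6, 2)]
    [21, -513, -335, -156, 78, 36, -143, 173, -190, 17, -264, -145, 42, 40, 284, -397, -229,
    -167, 64, 310, -717, 79, 96, -147, -198, 72, 116, -216, 121, 87, 113, 483, 114, 196, 186,
    47, 68, -241, 18, 175, 15, 20, 159, 193, 25] = true := by
  decide +kernel

theorem classCert_neg1100315 : classCert 1 275079 14 (79, -24) (191, -93)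
    [(3, 0, 8, 1), (5, 2, 0, 0), (7, 0, 5, 0), (11, 4, 6, 1)]
    [83, -238, -91, -106, -279, 9, 27, -214, -44, 182, 204, 39, 15, 46, 26, -138, -85, -127,
    -98, 50, -129, 92, -108, -163, -211, 110, 102, 61, -148, 41, 57, 4, 42, 52, 12, -328, -264,
    169, 6, 118, -360, 32, 37, -253, 36, 89, 243, 55, 240, 146, 75, -333, 181, 164, 212, 214,
    76] = true := by
  decide +kernel

theorem classCert_neg1407379 : classCert 1 351845 10 (13, -1) (305, -85)
    [(5, 0, 8, 2), (11, 3, 7, 0), (13, 0, 1, 0), (17, 8, 0, 0)]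
    [-26, -1170, 569, 161, -30, -345, -404, -52, 170, -200, -156, -352, -83, 133, 22, 23, 53,
    -119, 30, -140, 8, 230, 14, 90, 19, -207, 96, 91, 106, 319, 32, 42, 134, 18, 36, -184, 157,
    127, 100, 394, 76, -376, -382, -273, 154, 113, 174, -420, 238, 216, -400, -361, 5, 234,
    -550, 26, 260, 21, 150, 267, 208, 85, 147] = true := by
  decide +kernel

theorem classCert_neg1677327 : classCert 1 419332 8 (256, -109) (172, -77)
    [(2, 0, 1, 0), (3, 1, 0, 0), (29, 13, 8, 0), (43, 9, 2, 1), (47, 1, 8, 1)]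
    [-96, -335, 162, -237, -159, 307, -77, 361, 42, -378, 189, 4, 609, 1176, -100, -548, 44, 91,
    35, -253, -302, 85, 148, 24, -233, 139, 106, 52, 22, 108, -410, -287, 159, 79, -349, 114,
    16, 21, 146, 94, 178, 132, 92, 238, 150, 72, 296, 100, 249, 294, 34, 168, 187, 144, 198, 5,
    354, 61, 291, 20] = true := by
  decide +kernel

theorem classCert_neg1727187 : classCert 1 431797 2 (37, -6) (499, -219)
    [(3, 1, 0, 0), (7, 3, 0, 0), (11, 5, 0, 0), (17, 4, 1, 2), (29, 6, 6, 1), (31, 1, 0, 2)]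
    [412, 745, 115, 556, -123, 130, -774, 253, -529, 46, 403, 35, 10, -439, 73, 1219, 51, 247,
    -181, 104, 68, 361, -447, 24, 1032, -298, 38, -210, -235, 156, -608, 153, -1101, -355, 118,
    139, -299, 202, 101, 13, 218, 97, -293, 21, 72, 31, 175, 58, 66, 89, -564, -419, 94, 77,
    319, 37, 240] = true := by
  decide +kernel

theorem classCert_neg194703 : classCert 1 48676 10 (28, -13) (94, -11)
    [(2, 0, 8, 1), (3, 1, 0, 0), (7, 1, 6, 2), (17, 3, 8, 2)]
    [115, -55, -65, 43, -37, 1, 5, 19, -58, -170, -99, 47, 12, -72, 24, 7, -73, 27, 10, 3, 66,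
    41, 55, 46, 102, 2, 116] = true := by
  decide +kernel

theorem classCert_neg494771 : classCert 1 123693 10 (45, -22) (135, -42)
    [(3, 0, 2, 1), (5, 1, 6, 1), (11, 1, 7, 2)]
    [-337, 9, -103, -87, -54, 213, 141, -67, -51, 21, 45, -94, 6, 11, 63, 57, 12, 33, -119, 32,
    1, -189, 64, 59, 8, 30, 5, 106, -132, 23, 44, -184, 71, 83, 134, 89, 40, 68, -276, 144,
    -222, 14, 15, 55, 127] = true := by
  decide +kernel

theorem classCert_neg150319 : classCert 1 37580 4 (10, -1) (100, -5)
    [(2, 0, 2, 1), (5, 0, 2, 2), (13, 6, 0, 0)]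
    [20, -436, 139, -71, 1, 4, -41, 15, -116, 19, -66, 24, 12, -90, -165, 39, 51, 3, -115, 22,
    48, 37, 90] = true := by
  decide +kernel

theorem classCert_neg294983 : classCert 1 73746 22 (51, -18) (42, -19)
    [(2, 0, 8, 2), (3, 0, 7, 2)]
    [394, -117, 45, 17, -54, 34, 6, -27, 5, 15, 23, 36, -102, 51, 121, 12, 30, 32, 63, 39, 1,
    47, 0, 20, 111, 126, 9, 128, 16, 120] = true := by
  decide +kernel

theorem classCert_neg389435 : classCert 1 97359 4 (9, -4) (215, -63)
    [(3, 0, 2, 0), (11, 1, 8, 0), (17, 0, 8, 2)]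
    [32, 782, 68, 34, -23, -24, 102, -52, 97, 177, 0, -60, -90, 41, 155, 45, -108, 362, 62, 30,
    1, 12, -120, 27, 60, 104, 47, 90, 29, 82, 66, 56, 98, 133, 14, 92, 137, 75, 3, 86, 116] =
    true := by
  decide +kernel

/-- For each discriminant `d` in the given list, every imaginary quadratic
field `ℚ(√d)` (i.e. every degree-2 number field containing a square root of
`d`; note `d < 0` forces the field to be imaginary) has 3-class group — the
Sylow 3-subgroup of the ideal class group of its ring of integers —
isomorphic to `Multiplicative (ZMod 9 × ZMod 3)` (of order 27). -/
theorem three_class_group_stmt14 :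
    ∀ d : ℤ, d ∈ ({-1103784, -1356215, -518835, -761855, -553807, -763972, -876948, -1100315, -1407379, -1677327, -1727187, -194703, -494771, -150319, -294983, -389435} : Set ℤ) →
    ∀ (K : Type) [inst : Field K] [inst2 : NumberField K],
      Module.finrank ℚ K = 2 → (∃ α : K, α ^ 2 = (d : K)) →
      ∀ P : Sylow 3 (ClassGroup (NumberField.RingOfIntegers K)),
        Nonempty (↥P ≃* Multiplicative (ZMod 9 × ZMod 3)) := by
  intro d hd K _ _ hK hα P
  simp only [Set.mem_insert_iff, Set.mem_singleton_iff] at hd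
  rcases hd with rfl | rfl | rfl | rfl | rfl | rfl | rfl | rfl |
    rfl | rfl | rfl | rfl | rfl | rfl | rfl | rfl
  · exact sylow_equiv_of_classCert hK hα classCert_neg1103784
      (isFundamental_of_cert_zero (by decide +kernel) (by norm_num)) (by norm_num) P
  · exact sylow_equiv_of_classCert hK hα classCert_neg1356215
      (isFundamental_of_cert_one (by decide +kernel)) (by norm_num) P
  · exact sylow_equiv_of_classCert hK hα classCert_neg518835
      (isFundamental_of_cert_one (by decide +kernel)) (by norm_num) P
  · exact sylow_equiv_of_classCert hK hα classCert_neg761855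
      (isFundamental_of_cert_one (by decide +kernel)) (by norm_num) P
  · exact sylow_equiv_of_classCert hK hα classCert_neg553807
      (isFundamental_of_cert_one (by decide +kernel)) (by norm_num) P
  · exact sylow_equiv_of_classCert hK hα classCert_neg763972
      (isFundamental_of_cert_zero (by decide +kernel) (by norm_num)) (by norm_num) P
  · exact sylow_equiv_of_classCert hK hα classCert_neg876948
      (isFundamental_of_cert_zero (by decide +kernel) (by norm_num)) (by norm_num) P
  · exact sylow_equiv_of_classCert hK hα classCert_neg1100315
      (isFundamental_of_cert_one (by decide +kernel)) (by norm_num) P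
  · exact sylow_equiv_of_classCert hK hα classCert_neg1407379
      (isFundamental_of_cert_one (by decide +kernel)) (by norm_num) P
  · exact sylow_equiv_of_classCert hK hα classCert_neg1677327
      (isFundamental_of_cert_one (by decide +kernel)) (by norm_num) P
  · exact sylow_equiv_of_classCert hK hα classCert_neg1727187
      (isFundamental_of_cert_one (by decide +kernel)) (by norm_num) P
  · exact sylow_equiv_of_classCert hK hα classCert_neg194703
      (isFundamental_of_cert_one (by decide +kernel)) (by norm_num) P
  · exact sylow_equiv_of_classCert hK hα classCert_neg494771
      (isFundamental_of_cert_one (by decide +kernel)) (by norm_num) P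
  · exact sylow_equiv_of_classCert hK hα classCert_neg150319
      (isFundamental_of_cert_one (by decide +kernel)) (by norm_num) P
  · exact sylow_equiv_of_classCert hK hα classCert_neg294983
      (isFundamental_of_cert_one (by decide +kernel)) (by norm_num) P
  · exact sylow_equiv_of_classCert hK hα classCert_neg389435
      (isFundamental_of_cert_one (by decide +kernel)) (by norm_num) P
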